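/- arXiv:1106.0112 — 8 statements merged into one kernel-verified Lean document; each statement's English description precedes it below -/
import Mathlib

section
/- The pseudo-bosonic commutation relation holds if and only if the two superpotentials sum to 2x plus a constant: one has a(b f) − b(a f) = f for every smooth function f : ℝ → ℂ if and only if there exists α ∈ ℂ such that W_a(x) + W_b(x) = 2x + α for all x ∈ ℝ. (Equivalently, [a,b]f = ½(W_a′ + W_b′)f, so [a,b] = 1 iff W_a′ + W_b′ ≡ 2.) -/
noncomputable section

/-- The pseudo-bosonic lowering operator `a f = (1/√2)(f′ + W_a f)`. -/
def pbLower (Wa : ℝ → ℂ) (f : ℝ → ℂ) : ℝ → ℂ :=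
  fun x => (1 / (Real.sqrt 2 : ℂ)) * (deriv f x + Wa x * f x)

/-- The pseudo-bosonic raising operator `b f = (1/√2)(−f′ + W_b f)`. -/
def pbRaise (Wb : ℝ → ℂ) (f : ℝ → ℂ) : ℝ → ℂ :=
  fun x => (1 / (Real.sqrt 2 : ℂ)) * (-(deriv f x) + Wb x * f x)

/-- The commutator formula `[a,b] f = ½ (W_a′ + W_b′) f`. -/
theorem pb_commutator_formula
    (Wa Wb : ℝ → ℂ) (hWa : Differentiable ℝ Wa) (hWb : Differentiable ℝ Wb)
    (f : ℝ → ℂ) (hf : ContDiff ℝ (⊤ : ℕ∞) f) (x : ℝ) :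
    pbLower Wa (pbRaise Wb f) x - pbRaise Wb (pbLower Wa f) x
      = (1 / 2) * (deriv Wa x + deriv Wb x) * f x := by
  have hs : ((1 : ℂ) / (Real.sqrt 2 : ℂ)) * (1 / (Real.sqrt 2 : ℂ)) = 1 / 2 := by
    rw [div_mul_div_comm, ← Complex.ofReal_mul, Real.mul_self_sqrt (by norm_num)]
    norm_num
  have h1 : HasDerivAt f (deriv f x) x :=
    ((hf.differentiable (by simp)) x).hasDerivAt
  have h2 : HasDerivAt (deriv f) (deriv (deriv f) x) x := by
    have h := (contDiff_infty_iff_deriv.1 hf).2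
    exact ((h.differentiable (by simp)) x).hasDerivAt
  have ha := (hWa x).hasDerivAt
  have hb := (hWb x).hasDerivAt
  have hR : deriv (pbRaise Wb f) x = _ :=
    ((h2.neg.add (hb.mul h1)).const_mul (1 / (Real.sqrt 2 : ℂ))).deriv
  have hL : deriv (pbLower Wa f) x = _ :=
    ((h2.add (ha.mul h1)).const_mul (1 / (Real.sqrt 2 : ℂ))).deriv
  change (1 / (Real.sqrt 2 : ℂ)) * (deriv (pbRaise Wb f) x + Wa x * pbRaise Wb f x)
    - (1 / (Real.sqrt 2 : ℂ)) * (-(deriv (pbLower Wa f) x) + Wb x * pbLower Wa f x) = _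
  rw [hR, hL]
  simp only [pbLower, pbRaise]
  rw [← hs]
  ring

/-- **`[a,b] = 1` iff the superpotentials sum to `2x + α`.**
For differentiable superpotentials `W_a, W_b : ℝ → ℂ`, one has
`a(b f) − b(a f) = f` for every smooth `f : ℝ → ℂ` if and only if there exists a
constant `α ∈ ℂ` with `W_a(x) + W_b(x) = 2x + α` for all `x ∈ ℝ`. -/
theorem pseudoBoson_commutator_iff_superpotential_sum
    (Wa Wb : ℝ → ℂ) (hWa : Differentiable ℝ Wa) (hWb : Differentiable ℝ Wb) :
    (∀ f : ℝ → ℂ, ContDiff ℝ (⊤ : ℕ∞) f →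
        ∀ x : ℝ, pbLower Wa (pbRaise Wb f) x - pbRaise Wb (pbLower Wa f) x = f x) ↔
      ∃ α : ℂ, ∀ x : ℝ, Wa x + Wb x = 2 * (x : ℂ) + α := by
  have hd : ∀ x, HasDerivAt (fun y : ℝ => Wa y + Wb y) (deriv Wa x + deriv Wb x) x :=
    fun x => (hWa x).hasDerivAt.add (hWb x).hasDerivAt
  have hl : ∀ x : ℝ, HasDerivAt (fun y : ℝ => 2 * (y : ℂ)) 2 x := fun x => by
    simpa using (Complex.ofRealCLM.hasDerivAt (x := x)).const_mul (2 : ℂ)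
  constructor
  · intro h
    have hsum : ∀ x, deriv Wa x + deriv Wb x = 2 := fun x => by
      have h1 := h (fun _ => 1) contDiff_const x
      rw [pb_commutator_formula Wa Wb hWa hWb _ contDiff_const] at h1
      linear_combination 2 * h1
    have hz : ∀ x, HasDerivAt (fun y : ℝ => Wa y + Wb y - 2 * (y : ℂ)) 0 x := fun x => by
      have h2 := (hd x).sub (hl x)
      rw [hsum x, sub_self] at h2
      exact h2
    refine ⟨Wa 0 + Wb 0 - 2 * ((0 : ℝ) : ℂ), fun x => ?_⟩
    have h3 := is_const_of_deriv_eq_zero (fun x => (hz x).differentiableAt)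
      (fun x => (hz x).deriv) x 0
    linear_combination h3
  · rintro ⟨α, hα⟩ f hf x
    have hsum : deriv Wa x + deriv Wb x = 2 := by
      have h2 := hd x
      rw [funext hα] at h2
      exact h2.unique ((hl x).add_const α)
    rw [pb_commutator_formula Wa Wb hWa hWb f hf, hsum]
    ring

end
end

section
/- For every n ∈ ℕ, applying the raising operator b n times to the vacuum function x ↦ exp(−w_a(x)) yields b^n(exp(−w_a))(x) = 2^{−n/2} p_n(x) exp(−w_a(x)) for all x ∈ ℝ. In particular the pseudo-bosonic eigenfunctions φ_n = (n!)^{−1/2} b^n exp(−w_a) are a common polynomial p_n times the vacuum Gaussian factor, with φ_n(x) = (n! 2^n)^{−1/2} p_n(x) exp(−w_a(x)). -/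
open Polynomial

noncomputable section

/-- The pseudo-bosonic raising operator `b f = (1/√2)(−f′ + (2x + α − w_a′) f)`. -/
def pbRaiseSusy (α : ℂ) (wa : ℝ → ℂ) (f : ℝ → ℂ) : ℝ → ℂ :=
  fun x => (1 / (Real.sqrt 2 : ℂ)) *
    (-(deriv f x) + (2 * (x : ℂ) + α - deriv wa x) * f x)

/-- **The raised vacua are a common polynomial times the vacuum.**
Let `p 0 = 1`, `p (n+1) = (2X + α)·p n − (p n)′`, let `w_a : ℝ → ℂ` be smooth and
`b` the raising operator above.  Then `bⁿ(e^{−w_a})(x) = 2^{−n/2} pₙ(x) e^{−w_a(x)}`,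
and in particular `φₙ(x) = (n!)^{−1/2} bⁿ(e^{−w_a})(x) = (n!·2ⁿ)^{−1/2} pₙ(x) e^{−w_a(x)}`. -/
theorem raised_vacua_eq_polynomial_times_gaussian
    (α : ℂ) (p : ℕ → Polynomial ℂ)
    (hp0 : p 0 = 1)
    (hprec : ∀ n, p (n + 1) = (2 * X + C α) * p n - derivative (p n))
    (wa : ℝ → ℂ) (hwa : ContDiff ℝ (⊤ : ℕ∞) wa) :
    (∀ n : ℕ, ∀ x : ℝ,
      (pbRaiseSusy α wa)^[n] (fun t : ℝ => Complex.exp (-(wa t))) x =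
        ((Real.sqrt 2 : ℂ))⁻¹ ^ n * (p n).eval (x : ℂ) * Complex.exp (-(wa x))) ∧
    (∀ n : ℕ, ∀ x : ℝ,
      ((Real.sqrt (Nat.factorial n) : ℂ))⁻¹ *
          (pbRaiseSusy α wa)^[n] (fun t : ℝ => Complex.exp (-(wa t))) x =
        ((Real.sqrt (Nat.factorial n * 2 ^ n) : ℂ))⁻¹ *
          (p n).eval (x : ℂ) * Complex.exp (-(wa x))) := by
  have key : ∀ n : ℕ, (pbRaiseSusy α wa)^[n] (fun t : ℝ => Complex.exp (-(wa t))) =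
      fun x : ℝ => ((Real.sqrt 2 : ℂ))⁻¹ ^ n * (p n).eval (x : ℂ) * Complex.exp (-(wa x)) := by
    intro n
    induction n with
    | zero => funext x; simp [hp0]
    | succ n ih =>
      rw [Function.iterate_succ_apply', ih]
      funext x
      have hw : HasDerivAt wa (deriv wa x) x :=
        ((hwa.differentiable (by simp)) x).hasDerivAt
      have hE : HasDerivAt (fun t : ℝ => Complex.exp (-(wa t)))
          (Complex.exp (-(wa x)) * (-(deriv wa x))) x := hw.neg.cexp
      have hP : HasDerivAt (fun t : ℝ => (p n).eval (t : ℂ))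
          ((derivative (p n)).eval (x : ℂ)) x := ((p n).hasDerivAt (x : ℂ)).comp_ofReal
      have hD := ((hP.const_mul (((Real.sqrt 2 : ℂ))⁻¹ ^ n)).mul hE).deriv
      have hD' : deriv (fun x : ℝ => ((Real.sqrt 2 : ℂ))⁻¹ ^ n * (p n).eval (x : ℂ) *
          Complex.exp (-(wa x))) x = _ := hD
      simp only [pbRaiseSusy]
      rw [hD', hprec]
      simp only [eval_sub, eval_mul, eval_add, eval_X, eval_C, eval_ofNat]
      ring
  refine ⟨fun n x => congrFun (key n) x, fun n x => ?_⟩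
  rw [key n]
  have h2 : Real.sqrt (2 ^ n) = Real.sqrt 2 ^ n := by
    rw [Real.sqrt_eq_iff_eq_sq (by positivity) (by positivity), ← pow_mul, mul_comm, pow_mul,
      Real.sq_sqrt (by norm_num)]
  rw [Real.sqrt_mul (by positivity), h2]
  push_cast
  rw [mul_inv, inv_pow]
  ring

end
end

section
/- For all n, m ∈ ℕ, ∫_ℝ p_n(x) p_m(x) e^{−(x² + αx)} dx = δ_{n,m} · n! · 2^n · √π · e^{α²/4}, where δ_{n,m} = 1 if n = m and 0 otherwise. In particular the biorthogonality relation ⟨φ_n, Ψ_m⟩ = δ_{n,m} ⟨φ_0, Ψ_0⟩ holds for the pseudo-bosonic eigenfunctions with these polynomial parts. -/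
open Polynomial MeasureTheory

lemma pb_integrable_gauss (q : Polynomial ℝ) :
    Integrable (fun x : ℝ => q.eval x * Real.exp (-1 * x ^ 2)) := by
  induction q using Polynomial.induction_on' with
  | add p q hp hq =>
    simp only [eval_add, add_mul]
    exact hp.add hq
  | monomial n a =>
    have h := integrable_rpow_mul_exp_neg_mul_sq (b := 1) one_pos (s := (n : ℝ))
      (by have : (0 : ℝ) ≤ n := Nat.cast_nonneg n
          linarith)
    simp only [Real.rpow_natCast] at h
    simp only [eval_monomial, mul_assoc]
    exact h.const_mul a

lemma pb_weight (α x : ℝ) : Real.exp (-(x ^ 2 + α * x)) =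
    Real.exp (-1 * (x + α / 2) ^ 2) * Real.exp (α ^ 2 / 4) := by
  rw [← Real.exp_add]
  congr 1
  ring

lemma pb_integrable (α : ℝ) (q : Polynomial ℝ) :
    Integrable (fun x : ℝ => q.eval x * Real.exp (-(x ^ 2 + α * x))) := by
  have h := ((pb_integrable_gauss (q.comp (X - C (α / 2)))).comp_add_right (α / 2)).mul_const
    (Real.exp (α ^ 2 / 4))
  refine h.congr (Filter.Eventually.of_forall fun x => ?_)
  simp only [pb_weight, eval_comp, eval_sub, eval_X, eval_C, add_sub_cancel_right, mul_assoc]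

lemma pb_zero (α : ℝ) (q : Polynomial ℝ) :
    ∫ x : ℝ, ((2 * X + C α) * q - derivative q).eval x * Real.exp (-(x ^ 2 + α * x)) = 0 := by
  refine integral_eq_zero_of_hasDerivAt_of_integrable
    (f := fun x : ℝ => (-q).eval x * Real.exp (-(x ^ 2 + α * x))) (fun x => ?_)
    (pb_integrable α _) (pb_integrable α _)
  have h1 := (-q).hasDerivAt x
  have h2 : HasDerivAt (fun x : ℝ => -(x ^ 2 + α * x)) (-(2 * x + α)) x := by
    have := (((hasDerivAt_id x).pow 2).add ((hasDerivAt_id x).const_mul α)).neg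
    exact this.congr_deriv (by simp)
  refine (h1.mul h2.exp).congr_deriv ?_
  simp only [eval_sub, eval_mul, eval_add, eval_neg, eval_X, eval_C, derivative_neg, eval_ofNat]
  ring

lemma pb_base (α : ℝ) : ∫ x : ℝ, Real.exp (-(x ^ 2 + α * x)) =
    Real.sqrt Real.pi * Real.exp (α ^ 2 / 4) := by
  simp only [pb_weight]
  rw [integral_mul_const, integral_add_right_eq_self (fun x : ℝ => Real.exp (-1 * x ^ 2)),
    integral_gaussian, div_one]

lemma pb_shift (α : ℝ) (p q : Polynomial ℝ) :
    ∫ x : ℝ, ((2 * X + C α) * p - derivative p).eval x * q.eval x *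
      Real.exp (-(x ^ 2 + α * x)) =
    ∫ x : ℝ, p.eval x * (derivative q).eval x * Real.exp (-(x ^ 2 + α * x)) := by
  rw [← sub_eq_zero]
  simp only [← eval_mul]
  rw [← integral_sub (pb_integrable α _) (pb_integrable α _), ← pb_zero α (p * q)]
  congr 1
  ext x
  rw [← sub_mul, ← eval_sub, derivative_mul]
  congr 2
  ring

lemma pb_deriv (α : ℝ) (p : ℕ → Polynomial ℝ) (hp0 : p 0 = 1)
    (hprec : ∀ n, p (n + 1) = (2 * X + C α) * p n - derivative (p n)) (n : ℕ) :
    derivative (p (n + 1)) = C (2 * ((n : ℝ) + 1)) * p n := by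
  induction n with
  | zero =>
    have h2 : (C 2 : Polynomial ℝ) = 2 := rfl
    simp [hprec, hp0, h2]
  | succ n ih =>
    rw [hprec (n + 1), derivative_sub, derivative_mul, ih, derivative_C_mul]
    rw [show derivative (2 * X + C α : Polynomial ℝ) = 2 by simp]
    have h2 : (C 2 : Polynomial ℝ) = 2 := rfl
    have := hprec n
    simp only [C_mul, C_add, C_1, Nat.cast_add, Nat.cast_one, h2]
    linear_combination (-(2 * (C (n : ℝ) + 1))) * this

/-- **Orthogonality of the pseudo-bosonic polynomials against `e^{−(x²+αx)}`.**
With `α ∈ ℝ`, `p 0 = 1` and `p (n+1) = (2X + α)·p n − (p n)′`, one has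
`∫_ℝ pₙ(x) pₘ(x) e^{−(x²+αx)} dx = δ_{n,m} · n! · 2ⁿ · √π · e^{α²/4}`. -/
theorem pseudoBoson_polynomials_biorthogonality
    (α : ℝ) (p : ℕ → Polynomial ℝ)
    (hp0 : p 0 = 1)
    (hprec : ∀ n, p (n + 1) = (2 * X + C α) * p n - derivative (p n)) :
    ∀ n m : ℕ,
      ∫ x : ℝ, (p n).eval x * (p m).eval x * Real.exp (-(x ^ 2 + α * x)) =
        (if n = m then 1 else 0) * (Nat.factorial n : ℝ) * 2 ^ n *
          Real.sqrt Real.pi * Real.exp (α ^ 2 / 4) := by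
  intro n
  induction n with
  | zero =>
    intro m
    cases m with
    | zero => simpa [hp0] using pb_base α
    | succ m =>
      have h := pb_shift α (p m) (p 0)
      rw [← hprec] at h
      simpa [hp0] using h
  | succ n ih =>
    intro m
    rw [hprec n, pb_shift]
    cases m with
    | zero => simp [hp0]
    | succ m =>
      have h : ∀ x : ℝ, (p n).eval x * (derivative (p (m + 1))).eval x *
          Real.exp (-(x ^ 2 + α * x)) = (2 * ((m : ℝ) + 1)) *
          ((p n).eval x * (p m).eval x * Real.exp (-(x ^ 2 + α * x))) := by
        intro x
        rw [pb_deriv α p hp0 hprec, eval_mul, eval_C]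
        ring
      simp only [h]
      rw [integral_const_mul, ih m]
      by_cases hnm : n = m
      · subst hnm
        simp only [if_true, Nat.factorial_succ]
        push_cast
        ring
      · simp [hnm]
end

section
/- For every n ≥ 1, the derivative of p_n satisfies p_n′(x) = 2n · p_{n−1}(x) (identity of polynomials). This is the polynomial form of the statement that the operator a acts as a lowering operator on the pseudo-bosonic eigenfunctions, a φ_n = √n φ_{n−1}. -/
open Polynomial

/-- **The lowering identity for the pseudo-bosonic polynomials.**
With `p 0 = 1` and `p (n+1) = (2X + α)·p n − (p n)′`, for every `n ≥ 1` one has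
`(pₙ)′ = 2n · p_{n−1}` as polynomials (the polynomial form of `a φₙ = √n φ_{n−1}`). -/
theorem pseudoBoson_polynomials_lowering
    (α : ℂ) (p : ℕ → Polynomial ℂ)
    (hp0 : p 0 = 1)
    (hprec : ∀ n, p (n + 1) = (2 * X + C α) * p n - derivative (p n)) :
    ∀ n : ℕ, 1 ≤ n → derivative (p n) = C (2 * (n : ℂ)) * p (n - 1) := by
  have hd : derivative (2 * X + C α : Polynomial ℂ) = C 2 := by
    have h2 : (2 : Polynomial ℂ) = C 2 := rfl
    rw [h2, derivative_add, derivative_C_mul, derivative_X, derivative_C, mul_one, add_zero]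
  have key : ∀ n : ℕ, derivative (p (n + 1)) = C (2 * ((n + 1 : ℕ) : ℂ)) * p n := by
    intro n
    induction n with
    | zero =>
      rw [hprec 0, hp0]
      simp only [derivative_one, mul_one, sub_zero, hd]
      simp
    | succ k ih =>
      have hc : (C (2 * ((k + 1 + 1 : ℕ) : ℂ)) : Polynomial ℂ)
          = C 2 + C (2 * ((k + 1 : ℕ) : ℂ)) := by
        rw [← C_add]
        congr 1
        push_cast
        ring
      rw [hprec (k + 1), derivative_sub, derivative_mul, hd, ih, derivative_C_mul, hc]
      linear_combination (-C (2 * ((k + 1 : ℕ) : ℂ))) * hprec k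
  intro n hn
  obtain ⟨m, rfl⟩ : ∃ m, n = m + 1 := ⟨n - 1, by omega⟩
  simpa using key m
end

section
/- For all n, m ∈ ℕ, ∫_ℝ H_n(e^{−iθ}x) · H_m(e^{−iθ}x) · exp(−e^{−2iθ} x²) dx = δ_{n,m} · e^{iθ} · √( π · 2^{n+m} · n! · m! ), where δ_{n,m} = 1 if n = m and 0 otherwise, and H_n is evaluated at the complex number e^{−iθ}x. Consequently the Swanson eigenfunctions φ_n(x) = N₁ (2^n n!)^{−1/2} H_n(e^{iθ}x) exp(−½e^{2iθ}x²) and Ψ_m(x) = N₂ (2^m m!)^{−1/2} H_m(e^{−iθ}x) exp(−½e^{−2iθ}x²) satisfy ⟨φ_n, Ψ_m⟩ = δ_{n,m} whenever conj(N₁)·N₂ = e^{−iθ}/√π. -/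
open Polynomial MeasureTheory

lemma sw_integrable_pow {b : ℂ} (hb : 0 < b.re) (n : ℕ) :
    Integrable (fun x : ℝ => (x : ℂ) ^ n * Complex.exp (-b * (x : ℂ) ^ 2)) := by
  have h := integrable_rpow_mul_exp_neg_mul_sq hb (s := n)
    (by have : (0 : ℝ) ≤ n := n.cast_nonneg
        linarith)
  refine h.mono (by fun_prop) (Filter.Eventually.of_forall fun x => ?_)
  rw [norm_mul, norm_mul, norm_cexp_neg_mul_sq]
  simp

lemma sw_integrable {b : ℂ} (hb : 0 < b.re) (a : ℂ) (P : Polynomial ℂ) :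
    Integrable (fun x : ℝ => P.eval (a * (x : ℂ)) * Complex.exp (-b * (x : ℂ) ^ 2)) := by
  induction P using Polynomial.induction_on' with
  | add p q hp hq =>
    refine (hp.add hq).congr (Filter.Eventually.of_forall fun x => ?_)
    simp [add_mul]
  | monomial n c =>
    refine ((sw_integrable_pow hb n).const_mul (c * a ^ n)).congr
      (Filter.Eventually.of_forall fun x => ?_)
    simp only [eval_monomial, mul_pow]
    ring

noncomputable def swL (a : ℂ) (P : Polynomial ℂ) : ℂ :=
  ∫ x : ℝ, P.eval (a * (x : ℂ)) * Complex.exp (-(a ^ 2) * (x : ℂ) ^ 2)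

lemma swL_sub {a : ℂ} (hb : 0 < (a ^ 2).re) (P Q : Polynomial ℂ) :
    swL a (P - Q) = swL a P - swL a Q := by
  unfold swL
  rw [← integral_sub (sw_integrable hb a P) (sw_integrable hb a Q)]
  simp only [eval_sub, sub_mul]

lemma swL_C_mul (a c : ℂ) (P : Polynomial ℂ) : swL a (C c * P) = c * swL a P := by
  unfold swL
  rw [← integral_const_mul]
  simp only [eval_mul, eval_C, mul_assoc]

lemma swL_ibp {a : ℂ} (hb : 0 < (a ^ 2).re) (P : Polynomial ℂ) :
    swL a (2 * X * P) = swL a (derivative P) := by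
  have ha : a ≠ 0 := by
    rintro rfl
    simp at hb
  have key : swL a (C a * (derivative P - 2 * X * P)) = 0 := by
    refine integral_eq_zero_of_hasDerivAt_of_integrable
      (f := fun x : ℝ => P.eval (a * (x : ℂ)) * Complex.exp (-(a ^ 2) * (x : ℂ) ^ 2)) ?_
      (sw_integrable hb a _) (sw_integrable hb a _)
    intro x
    have h1 : HasDerivAt (fun z : ℂ => P.eval (a * z)) ((derivative P).eval (a * x) * a) (x : ℂ) :=
      (P.hasDerivAt (a * x)).comp (x : ℂ) (by simpa using (hasDerivAt_id (x : ℂ)).const_mul a)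
    have h2 : HasDerivAt (fun z : ℂ => Complex.exp (-(a ^ 2) * z ^ 2))
        (Complex.exp (-(a ^ 2) * (x : ℂ) ^ 2) * (-(a ^ 2) * (2 * x))) (x : ℂ) := by
      have := ((hasDerivAt_pow 2 (x : ℂ)).const_mul (-(a ^ 2))).cexp
      simpa using this
    have h3 := (h1.mul h2).comp_ofReal
    refine HasDerivAt.congr_deriv h3 ?_
    simp only [eval_mul, eval_sub, eval_C, eval_X, eval_ofNat]
    ring
  rw [swL_C_mul, swL_sub hb] at key
  rcases mul_eq_zero.1 key with h | h
  · exact absurd h ha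
  · exact (sub_eq_zero.1 h).symm

lemma sw_derivative (H : ℕ → Polynomial ℂ) (hH0 : H 0 = 1)
    (hHrec : ∀ n, H (n + 1) = 2 * X * H n - derivative (H n)) (n : ℕ) :
    derivative (H (n + 1)) = C (2 * (n + 1) : ℂ) * H n := by
  have hC : (C (2 : ℂ) : Polynomial ℂ) = 2 := rfl
  induction n with
  | zero => simp [hHrec, hH0, hC]
  | succ k ih =>
    rw [hHrec (k + 1), derivative_sub, ih, derivative_mul, ih, derivative_mul, hHrec k]
    simp [hC]
    ring

lemma swL_succ {a : ℂ} (hb : 0 < (a ^ 2).re) (H : ℕ → Polynomial ℂ)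
    (hHrec : ∀ n, H (n + 1) = 2 * X * H n - derivative (H n)) (n : ℕ) (Q : Polynomial ℂ) :
    swL a (H (n + 1) * Q) = swL a (H n * derivative Q) := by
  rw [hHrec, sub_mul, swL_sub hb, mul_assoc, swL_ibp hb, ← swL_sub hb, derivative_mul]
  congr 1
  ring

lemma swL_main {a : ℂ} (hb : 0 < (a ^ 2).re) (H : ℕ → Polynomial ℂ) (hH0 : H 0 = 1)
    (hHrec : ∀ n, H (n + 1) = 2 * X * H n - derivative (H n)) (n m : ℕ) :
    swL a (H n * H m) = if n = m then (2 ^ n * n.factorial : ℂ) * swL a 1 else 0 := by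
  have hz : ∀ k, swL a (H (k + 1) * 1) = 0 := by
    intro k
    rw [swL_succ hb H hHrec]
    simp [swL]
  induction n generalizing m with
  | zero =>
    cases m with
    | zero => simp [hH0]
    | succ m =>
      rw [hH0, mul_comm, hz]
      simp
  | succ n ih =>
    cases m with
    | zero =>
      rw [hH0, hz]
      simp
    | succ m =>
      rw [swL_succ hb H hHrec, sw_derivative H hH0 hHrec, mul_left_comm, swL_C_mul, ih]
      by_cases h : n = m
      · subst h
        simp [Nat.factorial_succ]
        ring
      · simp [h]

lemma sw_cos_pos {θ : ℝ} (hθ : |θ| < Real.pi / 4) :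
    0 < ((Complex.exp (-(θ * Complex.I))) ^ 2).re := by
  rw [← Complex.exp_nat_mul]
  have : ((2 : ℕ) : ℂ) * (-(θ * Complex.I)) = ((-(2 * θ) : ℝ) : ℂ) * Complex.I := by
    push_cast
    ring
  rw [this, Complex.exp_ofReal_mul_I_re]
  have := abs_lt.1 hθ
  exact Real.cos_pos_of_mem_Ioo ⟨by linarith, by linarith⟩

lemma swL_one {θ : ℝ} (hθ : |θ| < Real.pi / 4) :
    swL (Complex.exp (-(θ * Complex.I))) 1 =
      Complex.exp (θ * Complex.I) * (Real.sqrt Real.pi : ℂ) := by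
  unfold swL
  simp only [eval_one, one_mul]
  rw [integral_gaussian_complex (sw_cos_pos hθ)]
  have h : (Real.pi : ℂ) / Complex.exp (-(θ * Complex.I)) ^ 2 =
      (Complex.exp (θ * Complex.I) * (Real.sqrt Real.pi : ℂ)) ^ 2 := by
    rw [Complex.exp_neg, mul_pow, ← Complex.ofReal_pow, Real.sq_sqrt Real.pi_pos.le]
    field_simp
  rw [h, one_div, Complex.sq_cpow_two_inv]
  rw [Complex.re_mul_ofReal, Complex.exp_ofReal_mul_I_re]
  have := abs_lt.1 hθ
  have := Real.pi_pos
  exact mul_pos (Real.cos_pos_of_mem_Ioo ⟨by linarith, by linarith⟩)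
    (Real.sqrt_pos.2 Real.pi_pos)

/-- **Biorthogonality of the Swanson eigenfunctions.**
Let `H 0 = 1`, `H (n+1) = 2X·H n − (H n)′` (physicists' Hermite polynomials, over `ℂ`)
and `|θ| < π/4`.  Then
`∫_ℝ Hₙ(e^{−iθ}x) Hₘ(e^{−iθ}x) e^{−e^{−2iθ}x²} dx = δ_{n,m} e^{iθ} √(π 2^{n+m} n! m!)`,
and consequently the Swanson eigenfunctions
`φₙ(x) = N₁ (2ⁿ n!)^{−1/2} Hₙ(e^{iθ}x) e^{−½e^{2iθ}x²}` and
`Ψₘ(x) = N₂ (2ᵐ m!)^{−1/2} Hₘ(e^{−iθ}x) e^{−½e^{−2iθ}x²}` satisfy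
`⟨φₙ, Ψₘ⟩ = δ_{n,m}` whenever `conj N₁ · N₂ = e^{−iθ}/√π`. -/
theorem swanson_biorthogonality
    (θ : ℝ) (hθ : |θ| < Real.pi / 4)
    (H : ℕ → Polynomial ℂ)
    (hH0 : H 0 = 1)
    (hHrec : ∀ n, H (n + 1) = 2 * X * H n - derivative (H n))
    (N₁ N₂ : ℂ)
    (hN : (starRingEnd ℂ) N₁ * N₂ = Complex.exp (-(θ * Complex.I)) / (Real.sqrt Real.pi : ℂ))
    (φ Ψ : ℕ → ℝ → ℂ)
    (hφ : ∀ n x, φ n x = N₁ * ((Real.sqrt (2 ^ n * Nat.factorial n) : ℝ) : ℂ)⁻¹ *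
      (H n).eval (Complex.exp (θ * Complex.I) * (x : ℂ)) *
      Complex.exp (-(1 / 2) * Complex.exp (2 * θ * Complex.I) * (x : ℂ) ^ 2))
    (hΨ : ∀ m x, Ψ m x = N₂ * ((Real.sqrt (2 ^ m * Nat.factorial m) : ℝ) : ℂ)⁻¹ *
      (H m).eval (Complex.exp (-(θ * Complex.I)) * (x : ℂ)) *
      Complex.exp (-(1 / 2) * Complex.exp (-(2 * θ * Complex.I)) * (x : ℂ) ^ 2)) :
    (∀ n m : ℕ,
      ∫ x : ℝ, (H n).eval (Complex.exp (-(θ * Complex.I)) * (x : ℂ)) *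
          (H m).eval (Complex.exp (-(θ * Complex.I)) * (x : ℂ)) *
          Complex.exp (-Complex.exp (-(2 * θ * Complex.I)) * (x : ℂ) ^ 2) =
        (if n = m then 1 else 0) * Complex.exp (θ * Complex.I) *
          ((Real.sqrt (Real.pi * 2 ^ (n + m) * Nat.factorial n * Nat.factorial m) : ℝ) : ℂ)) ∧
    (∀ n m : ℕ,
      ∫ x : ℝ, (starRingEnd ℂ) (φ n x) * Ψ m x = if n = m then 1 else 0) := by
  have hb := sw_cos_pos hθ
  have he : Complex.exp (-(2 * θ * Complex.I)) = Complex.exp (-(θ * Complex.I)) ^ 2 := by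
    rw [← Complex.exp_nat_mul]
    congr 1
    push_cast
    ring
  have key : ∀ n m : ℕ,
      ∫ x : ℝ, (H n).eval (Complex.exp (-(θ * Complex.I)) * (x : ℂ)) *
          (H m).eval (Complex.exp (-(θ * Complex.I)) * (x : ℂ)) *
          Complex.exp (-Complex.exp (-(2 * θ * Complex.I)) * (x : ℂ) ^ 2) =
        if n = m then (2 ^ n * n.factorial : ℂ) *
          (Complex.exp (θ * Complex.I) * (Real.sqrt Real.pi : ℂ)) else 0 := by
    intro n m
    rw [← swL_one hθ, ← swL_main hb H hH0 hHrec, he]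
    unfold swL
    simp only [eval_mul]
  refine ⟨?_, ?_⟩
  · intro n m
    rw [key]
    by_cases h : n = m
    · subst h
      have : Real.sqrt (Real.pi * 2 ^ (n + n) * n.factorial * n.factorial) =
          Real.sqrt Real.pi * (2 ^ n * n.factorial) := by
        rw [show Real.pi * 2 ^ (n + n) * n.factorial * n.factorial =
          Real.pi * (2 ^ n * n.factorial) ^ 2 by ring, Real.sqrt_mul Real.pi_pos.le,
          Real.sqrt_sq (by positivity)]
      rw [this]
      simp only [if_true]
      push_cast
      ring
    · simp [h]
  · intro n m
    have hreal : ∀ (P : Polynomial ℂ), (∀ k, (starRingEnd ℂ) (P.coeff k) = P.coeff k) →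
        ∀ z, (starRingEnd ℂ) (P.eval z) = P.eval ((starRingEnd ℂ) z) := by
      intro P hP z
      rw [eval_eq_sum, eval_eq_sum, Polynomial.sum, Polynomial.sum, map_sum]
      simp [hP]
    have hmap : ∀ n, (H n).map (starRingEnd ℂ) = H n := by
      intro n
      induction n with
      | zero => simp [hH0]
      | succ k ih => simp [hHrec, ih, ← derivative_map]
    have hcoef : ∀ n z, (starRingEnd ℂ) ((H n).eval z) = (H n).eval ((starRingEnd ℂ) z) := by
      intro n
      refine hreal _ fun k => ?_
      conv_rhs => rw [← hmap n]
      rw [coeff_map]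
    have hfun : ∀ x : ℝ, (starRingEnd ℂ) (φ n x) * Ψ m x =
        ((starRingEnd ℂ) N₁ * N₂ * ((Real.sqrt (2 ^ n * Nat.factorial n) : ℝ) : ℂ)⁻¹ *
          ((Real.sqrt (2 ^ m * Nat.factorial m) : ℝ) : ℂ)⁻¹) *
        ((H n).eval (Complex.exp (-(θ * Complex.I)) * (x : ℂ)) *
          (H m).eval (Complex.exp (-(θ * Complex.I)) * (x : ℂ)) *
          Complex.exp (-Complex.exp (-(2 * θ * Complex.I)) * (x : ℂ) ^ 2)) := by
      intro x
      have hs : Complex.exp (-Complex.exp (-(2 * θ * Complex.I)) * (x : ℂ) ^ 2) =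
          Complex.exp (-(1 / 2) * Complex.exp (-(2 * θ * Complex.I)) * (x : ℂ) ^ 2) *
          Complex.exp (-(1 / 2) * Complex.exp (-(2 * θ * Complex.I)) * (x : ℂ) ^ 2) := by
        rw [← Complex.exp_add]
        congr 1
        ring
      have hc1 : (starRingEnd ℂ) (Complex.exp (θ * Complex.I) * (x : ℂ)) =
          Complex.exp (-(θ * Complex.I)) * (x : ℂ) := by
        simp [← Complex.exp_conj]
      have hc2 : (starRingEnd ℂ)
          (Complex.exp (-(1 / 2) * Complex.exp (2 * θ * Complex.I) * (x : ℂ) ^ 2)) =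
          Complex.exp (-(1 / 2) * Complex.exp (-(2 * θ * Complex.I)) * (x : ℂ) ^ 2) := by
        simp [← Complex.exp_conj, show (starRingEnd ℂ) 2 = 2 from Complex.conj_ofNat 2]
      rw [hφ, hΨ, map_mul, map_mul, map_mul, hc2, hcoef, hc1, map_inv₀, Complex.conj_ofReal, hs]
      ring
    simp_rw [hfun]
    rw [integral_const_mul, key, hN]
    by_cases h : n = m
    · subst h
      have h1 : ((Real.sqrt (2 ^ n * Nat.factorial n) : ℝ) : ℂ) ^ 2 =
          (2 ^ n * n.factorial : ℂ) := by
        rw [← Complex.ofReal_pow, Real.sq_sqrt (by positivity)]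
        push_cast
        ring
      have h2 : ((Real.sqrt (2 ^ n * Nat.factorial n) : ℝ) : ℂ) ≠ 0 := by
        rw [Complex.ofReal_ne_zero]
        positivity
      have h3 : (Real.sqrt Real.pi : ℂ) ≠ 0 := by
        rw [Complex.ofReal_ne_zero]
        exact (Real.sqrt_pos.2 Real.pi_pos).ne'
      simp only [if_true]
      rw [← h1, Complex.exp_neg]
      have h4 := Complex.exp_ne_zero (θ * Complex.I)
      field_simp
    · simp [h]
end

section
/- The family of functions { x ↦ x^n · exp(−½ e^{2iθ} x²) : n ∈ ℕ } is complete in L²(ℝ, ℂ): the closure of its linear span equals all of L²(ℝ, ℂ). Consequently the family of Swanson eigenfunctions { x ↦ H_n(e^{iθ}x) exp(−½ e^{2iθ} x²) : n ∈ ℕ } is also complete in L²(ℝ, ℂ). -/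
open Polynomial MeasureTheory

lemma aux_fourier_inj (k : ℝ → ℂ) (hk : Integrable k)
    (h : ∀ t : ℝ, ∫ x : ℝ, Complex.exp (t * Complex.I * x) * k x = 0) : k =ᵐ[volume] 0 := by
  have hF : ∀ w, FourierTransform.fourier k w = 0 := by
    intro w
    rw [Real.fourier_real_eq_integral_exp_smul]
    rw [← h (-2 * Real.pi * w)]
    refine integral_congr_ae (Filter.Eventually.of_forall fun x => ?_)
    simp only [smul_eq_mul]
    congr 2
    push_cast; ring
  refine ae_eq_zero_of_integral_contDiff_smul_eq_zero hk.locallyIntegrable ?_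
  intro g hg hgs
  have hs' : HasCompactSupport (fun x => (g x : ℂ)) := hgs.comp_left (g := Complex.ofReal) rfl
  have hc' : ContDiff ℝ (↑(⊤ : ℕ∞)) (fun x => (g x : ℂ)) := Complex.ofRealCLM.contDiff.comp hg
  let f : SchwartzMap ℝ ℂ := hs'.toSchwartzMap hc'
  let f' := FourierTransformInv.fourierInv f
  have e : FourierTransform.fourier f' = f := FourierTransform.fourier_fourierInv_eq f
  have e' : ∀ x, FourierTransform.fourier (f' : ℝ → ℂ) x = g x := by
    intro x
    rw [← SchwartzMap.fourier_coe, e]; rfl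
  have := VectorFourier.integral_fourierIntegral_smul_eq_flip (e := Real.fourierChar) (L := innerₗ ℝ)
    (μ := volume) (ν := volume) Real.continuous_fourierChar (by exact continuous_inner) f'.integrable hk
  rw [flip_innerₗ] at this
  change ∫ x, FourierTransform.fourier (f' : ℝ → ℂ) x • k x = ∫ x, f' x • FourierTransform.fourier k x at this
  simp only [e', hF, smul_zero, integral_zero] at this
  simpa using this

lemma aux_int (b : ℂ) (hb : 0 < b.re) (h : Lp ℂ 2 (volume : Measure ℝ)) (a : ℝ) :
    Integrable (fun x : ℝ => Real.exp (|a * x|) * ‖Complex.exp (-b * (x:ℂ)^2) * star (h x)‖) := by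
  have h1 : MemLp (fun x : ℝ => Real.exp (-(b.re/2) * x^2)) 2 := by
    rw [memLp_two_iff_integrable_sq (by fun_prop)]
    refine (integrable_exp_neg_mul_sq hb).congr (Filter.Eventually.of_forall fun x => ?_)
    simp only [← Real.exp_nat_mul]
    congr 1; push_cast; ring
  have h2 : MemLp (fun x : ℝ => Real.exp (a^2/(2*b.re)) * Real.exp (-(b.re/2) * x^2)) 2 := h1.const_mul _
  have h3 := h2.integrable_mul (Lp.memLp h).norm
  refine h3.mono ?_ (Filter.Eventually.of_forall fun x => ?_)
  · have := (Lp.memLp h).1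
    have e := this.norm
    simp only [norm_mul, norm_star]
    refine AEStronglyMeasurable.mul (by fun_prop) (AEStronglyMeasurable.mul ?_ e)
    exact (by fun_prop : Continuous fun x : ℝ => ‖Complex.exp (-b * (x:ℂ)^2)‖).aestronglyMeasurable
  · have : (-b * (x:ℂ)^2).re = -b.re * x^2 := by
      rw [← Complex.ofReal_pow, Complex.re_mul_ofReal]; simp
    simp only [norm_mul, norm_star, Pi.mul_apply, Complex.norm_exp, Real.norm_eq_abs, Real.abs_exp, this]
    rw [← mul_assoc, ← Real.exp_add, ← Real.exp_add]
    refine mul_le_mul_of_nonneg_right (Real.exp_le_exp.2 ?_) (abs_nonneg _)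
    have : a^2/(2*b.re) + -(b.re/2) * x^2 - (|a*x| + -b.re*x^2) = (|a| - b.re*|x|)^2/(2*b.re) := by
      rw [abs_mul]
      field_simp
      rw [sub_sq, mul_pow, sq_abs, sq_abs]; ring
    have h0 : 0 ≤ (|a| - b.re*|x|)^2/(2*b.re) := by positivity
    linarith

lemma aux_zero (b : ℂ) (hb : 0 < b.re) (h : Lp ℂ 2 (volume : Measure ℝ))
    (hn : ∀ n : ℕ, ∫ x : ℝ, (x:ℂ)^n * (Complex.exp (-b * (x:ℂ)^2) * star (h x)) = 0) : h = 0 := by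
  set k : ℝ → ℂ := fun x => Complex.exp (-b * (x:ℂ)^2) * star (h x) with hk
  have hn' : ∀ n : ℕ, ∫ x : ℝ, (x:ℂ)^n * k x = 0 := hn
  have hkm : AEStronglyMeasurable k volume := by
    refine AEStronglyMeasurable.mul ?_ (Lp.memLp h).1.star
    exact (by fun_prop : Continuous fun x : ℝ => Complex.exp (-b * (x:ℂ)^2)).aestronglyMeasurable
  have hki : Integrable k := by
    have := aux_int b hb h 0
    simp only [zero_mul, abs_zero, Real.exp_zero, one_mul] at this
    exact (integrable_norm_iff hkm).1 this
  have hz := aux_fourier_inj k hki ?_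
  · rw [Lp.eq_zero_iff_ae_eq_zero]
    filter_upwards [hz] with x hx
    simpa [hk, Complex.exp_ne_zero] using hx
  intro t
  have hexp : ∀ x : ℝ, HasSum (fun n : ℕ => |t*x|^n / n.factorial * ‖k x‖) (Real.exp |t*x| * ‖k x‖) := by
    intro x
    have := NormedSpace.expSeries_div_hasSum_exp (𝔸 := ℝ) (|t*x|)
    rw [← Real.exp_eq_exp_ℝ] at this
    exact this.mul_right _
  have := hasSum_integral_of_dominated_convergence (μ := (volume : Measure ℝ))
    (F := fun (n : ℕ) (x : ℝ) => (t * Complex.I)^n / n.factorial * ((x:ℂ)^n * k x))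
    (f := fun x => Complex.exp (t * Complex.I * x) * k x)
    (fun n x => |t*x|^n / n.factorial * ‖k x‖) ?_ ?_ ?_ ?_ ?_
  · have hz : ∀ n : ℕ, ∫ x : ℝ, (t * Complex.I)^n / n.factorial * ((x:ℂ)^n * k x) = 0 := by
      intro n
      rw [integral_const_mul, hn' n, mul_zero]
    simp only [hz] at this
    exact this.unique hasSum_zero
  · intro n
    refine AEStronglyMeasurable.mul (by fun_prop) (AEStronglyMeasurable.mul ?_ hkm)
    exact (by fun_prop : Continuous fun x : ℝ => (x:ℂ)^n).aestronglyMeasurable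
  · intro n
    refine Filter.Eventually.of_forall fun x => le_of_eq ?_
    simp [abs_mul, mul_pow]; ring
  · exact Filter.Eventually.of_forall fun x => (hexp x).summable
  · simp only [fun x => (hexp x).tsum_eq]
    exact aux_int b hb h t
  · refine Filter.Eventually.of_forall fun x => ?_
    have := NormedSpace.expSeries_div_hasSum_exp (𝔸 := ℂ) (t * Complex.I * x)
    rw [← Complex.exp_eq_exp_ℂ] at this
    have e : (fun n : ℕ => (t * Complex.I)^n / n.factorial * ((x:ℂ)^n * k x)) =
        fun n : ℕ => (t * Complex.I * x)^n / n.factorial * k x := by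
      funext n
      rw [mul_pow _ (x:ℂ)]; ring
    rw [e]
    exact this.mul_right (k x)

lemma aux_span (H : ℕ → Polynomial ℂ)
    (hH0 : H 0 = 1)
    (hHrec : ∀ n, H (n + 1) = 2 * X * H n - derivative (H n)) :
    Submodule.span ℂ (Set.range H) = ⊤ := by
  have hd : ∀ n : ℕ, derivative (H (n+1)) = (2 * (n+1) : ℂ) • H n := by
    intro n
    induction n with
    | zero => rw [hHrec, hH0]; simp [smul_eq_C_mul, C_ofNat]
    | succ n ih =>
      rw [hHrec (n+1), derivative_sub, ih, derivative_mul, ih, derivative_smul]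
      have e : derivative (H n) = 2 * X * H n - H (n+1) := by rw [hHrec]; ring
      rw [e]
      simp only [smul_eq_C_mul]
      simp [C_ofNat]
      ring
  have hmem : ∀ n, H n ∈ Submodule.span ℂ (Set.range H) := fun n => Submodule.subset_span ⟨n, rfl⟩
  have hdm : ∀ n, derivative (H n) ∈ Submodule.span ℂ (Set.range H) := by
    intro n
    cases n with
    | zero => simp [hH0]
    | succ n => rw [hd]; exact Submodule.smul_mem _ _ (hmem n)
  have hX : ∀ p ∈ Submodule.span ℂ (Set.range H), X * p ∈ Submodule.span ℂ (Set.range H) := by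
    intro p hp
    induction hp using Submodule.span_induction with
    | mem p hp =>
      obtain ⟨n, rfl⟩ := hp
      have : X * H n = (1/2 : ℂ) • (H (n+1) + derivative (H n)) := by
        rw [hHrec, smul_eq_C_mul]
        have : (C (1/2 : ℂ)) * 2 = 1 := by
          rw [← C_ofNat, ← C_mul]; norm_num
        linear_combination (-X * H n) * this
      rw [this]
      exact Submodule.smul_mem _ _ (Submodule.add_mem _ (hmem _) (hdm _))
    | zero => simp
    | add p q _ _ hp hq => rw [mul_add]; exact Submodule.add_mem _ hp hq
    | smul a p _ hp => rw [mul_smul_comm]; exact Submodule.smul_mem _ _ hp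
  rw [eq_top_iff]
  rintro p -
  have hpow : ∀ n : ℕ, (X : ℂ[X])^n ∈ Submodule.span ℂ (Set.range H) := by
    intro n
    induction n with
    | zero => rw [pow_zero, ← hH0]; exact hmem 0
    | succ n ih => rw [pow_succ']; exact hX _ ih
  rw [p.as_sum_range_C_mul_X_pow]
  refine Submodule.sum_mem _ fun i _ => ?_
  rw [← smul_eq_C_mul]
  exact Submodule.smul_mem _ _ (hpow i)

/-- **Completeness of the Swanson families in `L²(ℝ, ℂ)`.**
For `|θ| < π/4`, the family `{x ↦ xⁿ e^{−½e^{2iθ}x²}}` is complete in `L²(ℝ, ℂ)`,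
and consequently so is the family of Swanson eigenfunctions
`{x ↦ Hₙ(e^{iθ}x) e^{−½e^{2iθ}x²}}`, where the `Hₙ` are the physicists' Hermite
polynomials (`H 0 = 1`, `H (n+1) = 2X·H n − (H n)′`).  Here `F n` (resp. `G n`)
denotes the `L²` element represented by the corresponding function. -/
theorem swanson_families_complete
    (θ : ℝ) (hθ : |θ| < Real.pi / 4)
    (H : ℕ → Polynomial ℂ)
    (hH0 : H 0 = 1)
    (hHrec : ∀ n, H (n + 1) = 2 * X * H n - derivative (H n))
    (F G : ℕ → Lp ℂ 2 (volume : Measure ℝ))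
    (hF : ∀ n, (F n : ℝ → ℂ) =ᵐ[volume] fun x : ℝ =>
      (x : ℂ) ^ n * Complex.exp (-(1 / 2) * Complex.exp (2 * θ * Complex.I) * (x : ℂ) ^ 2))
    (hG : ∀ n, (G n : ℝ → ℂ) =ᵐ[volume] fun x : ℝ =>
      (H n).eval (Complex.exp (θ * Complex.I) * (x : ℂ)) *
        Complex.exp (-(1 / 2) * Complex.exp (2 * θ * Complex.I) * (x : ℂ) ^ 2)) :
    (Submodule.span ℂ (Set.range F)).topologicalClosure = ⊤ ∧
    (Submodule.span ℂ (Set.range G)).topologicalClosure = ⊤ := by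
  have h1 : (Submodule.span ℂ (Set.range F)).topologicalClosure = ⊤ := by
    rw [Submodule.topologicalClosure_eq_top_iff, Submodule.eq_bot_iff]
    intro h hh
    refine aux_zero (1/2 * Complex.exp (2 * θ * Complex.I)) ?_ h ?_
    · have : (1/2 * Complex.exp (2 * θ * Complex.I)).re = 1/2 * Real.cos (2*θ) := by
        rw [show (2 * θ * Complex.I : ℂ) = ((2*θ : ℝ) : ℂ) * Complex.I by push_cast; ring,
          show (1/2 : ℂ) = ((1/2 : ℝ) : ℂ) by push_cast; ring, Complex.re_ofReal_mul,
          Complex.exp_ofReal_mul_I_re]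
      rw [this]
      obtain ⟨h1, h2⟩ := abs_lt.1 hθ
      have := Real.cos_pos_of_mem_Ioo (x := 2*θ) ⟨by linarith, by linarith⟩
      positivity
    · intro n
      have := (Submodule.mem_orthogonal' _ _).1 hh (F n) (Submodule.subset_span ⟨n, rfl⟩)
      rw [L2.inner_def] at this
      rw [← this]
      refine integral_congr_ae ?_
      filter_upwards [hF n] with x hx
      rw [hx]
      simp only [RCLike.inner_apply, neg_mul]
      rw [← mul_assoc ((x:ℂ)^n)]; rfl
  refine ⟨h1, ?_⟩
  rw [eq_top_iff, ← h1]
  apply Submodule.topologicalClosure_mono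
  rw [Submodule.span_le]
  rintro _ ⟨n, rfl⟩
  set c := Complex.exp (θ * Complex.I) with hc
  have hc0 : c ≠ 0 := Complex.exp_ne_zero _
  -- linear map from polynomials to L²
  let Ψ : ℂ[X] →ₗ[ℂ] Lp ℂ 2 (volume : Measure ℝ) := (Polynomial.basisMonomials ℂ).constr ℂ F
  have hΨ : ∀ m, Ψ (monomial m 1) = F m := by
    intro m
    have := (Polynomial.basisMonomials ℂ).constr_basis ℂ F m
    rwa [Polynomial.coe_basisMonomials] at this
  have hΨe : ∀ p : ℂ[X], (Ψ p : ℝ → ℂ) =ᵐ[volume] fun x : ℝ => p.eval (x:ℂ) *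
      Complex.exp (-(1 / 2) * Complex.exp (2 * θ * Complex.I) * (x : ℂ) ^ 2) := by
    intro p
    induction p using Polynomial.induction_on' with
    | add p q hp hq =>
      rw [map_add]
      filter_upwards [hp, hq, Lp.coeFn_add (Ψ p) (Ψ q)] with x h1 h2 h3
      rw [h3, Pi.add_apply, h1, h2, eval_add]; ring
    | monomial m a =>
      have : monomial m a = a • (monomial m (1:ℂ)) := by simp [smul_monomial]
      rw [this, map_smul, hΨ]
      filter_upwards [hF m, Lp.coeFn_smul a (F m)] with x h1 h2
      rw [h2, Pi.smul_apply, h1]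
      simp [mul_assoc]
  have hΨG : ∀ m, Ψ ((H m).comp (C c * X)) = G m := by
    intro m
    apply Lp.ext
    filter_upwards [hΨe ((H m).comp (C c * X)), hG m] with x h1 h2
    rw [h1, h2]; simp
  have hall : ∀ p ∈ Submodule.span ℂ (Set.range H),
      Ψ (p.comp (C c * X)) ∈ Submodule.span ℂ (Set.range G) := by
    intro p hp
    induction hp using Submodule.span_induction with
    | mem p hp =>
      obtain ⟨m, rfl⟩ := hp
      rw [hΨG]; exact Submodule.subset_span ⟨m, rfl⟩
    | zero => simp
    | add p q _ _ hp hq => rw [add_comp, map_add]; exact Submodule.add_mem _ hp hq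
    | smul a p _ hp => rw [smul_comp, map_smul]; exact Submodule.smul_mem _ _ hp
  have := hall ((C c⁻¹ * X)^n) (by rw [aux_span H hH0 hHrec]; trivial)
  have e : ((C c⁻¹ * X)^n : ℂ[X]).comp (C c * X) = monomial n 1 := by
    rw [pow_comp, mul_comp, C_comp, X_comp, ← mul_assoc, ← C_mul, inv_mul_cancel₀ hc0, C_1, one_mul,
      X_pow_eq_monomial]
  rw [e, hΨ] at this
  exact this
end

section
/- The pseudo-bosonic commutation relations [Q,P]f = i f, [Q′,P′]f = i f, [Q,P′]f = 0, [Q′,P]f = 0, [Q,Q′]f = 0 and [P,P′]f = 0 hold for every smooth f : ℝ² → ℂ if and only if the superpotentials satisfy the first-order constraints ∂W₁/∂x = ∂V₂/∂y, ∂W₂/∂x = −∂V₂/∂x, ∂W₁/∂y = −∂V₁/∂y, ∂W₂/∂y = ∂V₁/∂x, together with ∂V₁/∂x + ∂V₂/∂y = −1 and ∂W₁/∂x + ∂W₂/∂y = −1, at every point of ℝ². -/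
noncomputable section

/-- Partial derivative in the `x` direction of a function on `ℝ²`. -/
def pdx (f : ℝ × ℝ → ℂ) (p : ℝ × ℝ) : ℂ := fderiv ℝ f p (1, 0)

/-- Partial derivative in the `y` direction of a function on `ℝ²`. -/
def pdy (f : ℝ × ℝ → ℂ) (p : ℝ × ℝ) : ℂ := fderiv ℝ f p (0, 1)

theorem gll_fderiv_aux (B f : ℝ × ℝ → ℂ) (hB : Differentiable ℝ B)
    (hf : ContDiff ℝ (⊤ : ℕ∞) f) (p u v : ℝ × ℝ) :
    fderiv ℝ (fun q => -Complex.I * fderiv ℝ f q v + B q * f q) p u =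
      -Complex.I * fderiv ℝ (fderiv ℝ f) p u v + (B p * fderiv ℝ f p u + fderiv ℝ B p u * f p) := by
  have hf1 : HasFDerivAt f (fderiv ℝ f p) p :=
    (hf.differentiable (by simp) p).hasFDerivAt
  have hf2 : HasFDerivAt (fderiv ℝ f) (fderiv ℝ (fderiv ℝ f) p) p :=
    ((hf.fderiv_right (m := 1) (by norm_cast)).differentiable (by simp) p).hasFDerivAt
  have h3 := hf2.clm_apply (hasFDerivAt_const v p)
  have h4 := (h3.const_mul (-Complex.I)).add ((hB p).hasFDerivAt.mul hf1)
  have h5 := congrArg (fun L => L u) h4.fderiv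
  refine Eq.trans h5 ?_
  simp
  ring

theorem gll_comm_aux (A B f : ℝ × ℝ → ℂ) (hA : Differentiable ℝ A) (hB : Differentiable ℝ B)
    (hf : ContDiff ℝ (⊤ : ℕ∞) f) (p u v : ℝ × ℝ) :
    (-Complex.I * fderiv ℝ (fun q => -Complex.I * fderiv ℝ f q v + B q * f q) p u
        + A p * (-Complex.I * fderiv ℝ f p v + B p * f p)) -
      (-Complex.I * fderiv ℝ (fun q => -Complex.I * fderiv ℝ f q u + A q * f q) p v
        + B p * (-Complex.I * fderiv ℝ f p u + A p * f p)) =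
      -Complex.I * (fderiv ℝ B p u - fderiv ℝ A p v) * f p := by
  rw [gll_fderiv_aux B f hB hf, gll_fderiv_aux A f hA hf]
  have hs : fderiv ℝ (fderiv ℝ f) p u v = fderiv ℝ (fderiv ℝ f) p v u := by
    have : IsSymmSndFDerivAt ℝ f p :=
      hf.contDiffAt.isSymmSndFDerivAt (by simp; norm_cast)
    exact this u v
  rw [hs]
  ring

/-- **Pseudo-bosonic commutation relations for generalized Landau levels
hold iff the superpotentials satisfy the first-order constraints.**
With `P′f = −i∂ₓf + W₂f`, `Q′f = −i∂_yf − W₁f`, `Pf = −i∂_yf + V₁f`,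
`Qf = −i∂ₓf − V₂f`, the relations `[Q,P] = [Q′,P′] = i` and
`[Q,P′] = [Q′,P] = [Q,Q′] = [P,P′] = 0` on smooth functions hold iff
`W₁ₓ = V₂_y`, `W₂ₓ = −V₂ₓ`, `W₁_y = −V₁_y`, `W₂_y = V₁ₓ`,
`V₁ₓ + V₂_y = −1` and `W₁ₓ + W₂_y = −1` everywhere. -/
theorem gll_commutation_iff_superpotential_constraints
    (V₁ V₂ W₁ W₂ : ℝ × ℝ → ℂ)
    (hV₁ : ContDiff ℝ 1 V₁) (hV₂ : ContDiff ℝ 1 V₂)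
    (hW₁ : ContDiff ℝ 1 W₁) (hW₂ : ContDiff ℝ 1 W₂) :
    (let P' : (ℝ × ℝ → ℂ) → (ℝ × ℝ → ℂ) := fun f p => -Complex.I * pdx f p + W₂ p * f p
     let Q' : (ℝ × ℝ → ℂ) → (ℝ × ℝ → ℂ) := fun f p => -Complex.I * pdy f p - W₁ p * f p
     let P : (ℝ × ℝ → ℂ) → (ℝ × ℝ → ℂ) := fun f p => -Complex.I * pdy f p + V₁ p * f p
     let Q : (ℝ × ℝ → ℂ) → (ℝ × ℝ → ℂ) := fun f p => -Complex.I * pdx f p - V₂ p * f p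
     ∀ f : ℝ × ℝ → ℂ, ContDiff ℝ (⊤ : ℕ∞) f → ∀ p : ℝ × ℝ,
       Q (P f) p - P (Q f) p = Complex.I * f p ∧
       Q' (P' f) p - P' (Q' f) p = Complex.I * f p ∧
       Q (P' f) p - P' (Q f) p = 0 ∧
       Q' (P f) p - P (Q' f) p = 0 ∧
       Q (Q' f) p - Q' (Q f) p = 0 ∧
       P (P' f) p - P' (P f) p = 0) ↔
    (∀ p : ℝ × ℝ,
       pdx W₁ p = pdy V₂ p ∧
       pdx W₂ p = -pdx V₂ p ∧
       pdy W₁ p = -pdy V₁ p ∧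
       pdy W₂ p = pdx V₁ p ∧
       pdx V₁ p + pdy V₂ p = -1 ∧
       pdx W₁ p + pdy W₂ p = -1) := by
  have dV₁ := hV₁.differentiable one_ne_zero
  have dV₂ := hV₂.differentiable one_ne_zero
  have dW₁ := hW₁.differentiable one_ne_zero
  have dW₂ := hW₂.differentiable one_ne_zero
  have key : ∀ f : ℝ × ℝ → ℂ, ContDiff ℝ (⊤ : ℕ∞) f → ∀ p : ℝ × ℝ, _ := fun f hf p =>
    And.intro (gll_comm_aux (-V₂) V₁ f dV₂.neg dV₁ hf p (1, 0) (0, 1)) <|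
    And.intro (gll_comm_aux (-W₁) W₂ f dW₁.neg dW₂ hf p (0, 1) (1, 0)) <|
    And.intro (gll_comm_aux (-V₂) W₂ f dV₂.neg dW₂ hf p (1, 0) (1, 0)) <|
    And.intro (gll_comm_aux (-W₁) V₁ f dW₁.neg dV₁ hf p (0, 1) (0, 1)) <|
    And.intro (gll_comm_aux (-V₂) (-W₁) f dV₂.neg dW₁.neg hf p (1, 0) (0, 1))
    (gll_comm_aux V₁ W₂ f dV₁ dW₂ hf p (0, 1) (1, 0))
  simp only [Pi.neg_apply, neg_mul, ← sub_eq_add_neg, fderiv_neg, neg_apply] at key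
  simp only [pdx, pdy, neg_mul]
  have hI := Complex.I_ne_zero
  have hII := Complex.I_mul_I
  constructor
  · intro h p
    obtain ⟨h1, h2, h3, h4, h5, h6⟩ := h (fun _ => 1) contDiff_const p
    obtain ⟨k1, k2, k3, k4, k5, k6⟩ := key (fun _ => 1) contDiff_const p
    have e1 := k1.symm.trans h1
    have e2 := k2.symm.trans h2
    have e3 := k3.symm.trans h3
    have e4 := k4.symm.trans h4
    have e5 := k5.symm.trans h5
    have e6 := k6.symm.trans h6
    refine ⟨?_, ?_, ?_, ?_, ?_, ?_⟩ <;> apply mul_left_cancel₀ hI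
    · linear_combination e5
    · linear_combination -e3
    · linear_combination -e4
    · linear_combination -e6
    · linear_combination -e1
    · linear_combination -e2
  · intro h f hf p
    obtain ⟨h1, h2, h3, h4, h5, h6⟩ := h p
    obtain ⟨k1, k2, k3, k4, k5, k6⟩ := key f hf p
    refine ⟨k1.trans ?_, k2.trans ?_, k3.trans ?_, k4.trans ?_, k5.trans ?_, k6.trans ?_⟩
    · linear_combination (-Complex.I * f p) * h5
    · linear_combination (-Complex.I * f p) * h6
    · linear_combination (-Complex.I * f p) * h2
    · linear_combination (-Complex.I * f p) * h3
    · linear_combination (Complex.I * f p) * h1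
    · linear_combination (-Complex.I * f p) * h4

end
end

section
/- No choice of weights regularizes the damped harmonic oscillator vacua: for all real numbers c₁, c₂, it is impossible that simultaneously c₁ + Re(β·ω₊/Γ) > 0, c₂ − Re(δ/(α·ω₊)) > 0, Re(β·ω₊/Γ) − c₁ > 0, and c₂ + Re(δ/(α·ω₊)) < 0. Hence there is no weighted space L²(ℝ², e^{−c₁x²−c₂y²}dx dy) in which both the vacuum φ₀₀ and the dual vacuum Ψ₀₀ of the damped harmonic oscillator are square-integrable. -/
/-- **No weight regularizes the damped harmonic oscillator vacua.**
With `α = conj Γ / (Γ conj δ − δ conj Γ)`, `β = conj δ / (Γ conj δ − δ conj Γ)` and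
the quantization constraint `ω conj δ conj Γ = −conj ω δ Γ` (writing `ω` for `ω₊`),
for all real `c₁, c₂` it is impossible that simultaneously
`c₁ + Re(β ω / Γ) > 0`, `c₂ − Re(δ / (α ω)) > 0`, `Re(β ω / Γ) − c₁ > 0` and
`c₂ + Re(δ / (α ω)) < 0`: in no weighted space `L²(ℝ², e^{−c₁x²−c₂y²}dxdy)` are both
the vacuum `φ₀₀` and the dual vacuum `Ψ₀₀` square-integrable. -/
theorem dho_no_weight_regularizes
    (Γ δ ω : ℂ) (hΓ : Γ ≠ 0) (hδ : δ ≠ 0) (hω : ω ≠ 0)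
    (hden : Γ * (starRingEnd ℂ) δ - δ * (starRingEnd ℂ) Γ ≠ 0)
    (α β : ℂ)
    (hα : α = (starRingEnd ℂ) Γ / (Γ * (starRingEnd ℂ) δ - δ * (starRingEnd ℂ) Γ))
    (hβ : β = (starRingEnd ℂ) δ / (Γ * (starRingEnd ℂ) δ - δ * (starRingEnd ℂ) Γ))
    (hquant : ω * (starRingEnd ℂ) δ * (starRingEnd ℂ) Γ = -(starRingEnd ℂ) ω * δ * Γ) :
    ∀ c₁ c₂ : ℝ,
      ¬(0 < c₁ + (β * ω / Γ).re ∧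
        0 < c₂ - (δ / (α * ω)).re ∧
        0 < (β * ω / Γ).re - c₁ ∧
        c₂ + (δ / (α * ω)).re < 0) := by
  rintro c₁ c₂ ⟨h1, h2, h3, h4⟩
  have hA : 0 < (β * ω / Γ).re := by linarith
  have hB : (δ / (α * ω)).re < 0 := by linarith
  have hΓ' : (starRingEnd ℂ) Γ ≠ 0 := by simpa using hΓ
  have hδ' : (starRingEnd ℂ) δ ≠ 0 := by simpa using hδ
  -- `β ω / Γ` is real by the quantization constraint
  have hreal : (starRingEnd ℂ) (β * ω / Γ) = β * ω / Γ := by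
    have hneg : (starRingEnd ℂ) Γ * δ - (starRingEnd ℂ) δ * Γ
        = -(Γ * (starRingEnd ℂ) δ - δ * (starRingEnd ℂ) Γ) := by ring
    rw [hβ]
    simp only [map_div₀, map_mul, map_sub, Complex.conj_conj]
    rw [hneg, div_mul_eq_mul_div, div_mul_eq_mul_div, div_div, div_div,
      div_eq_div_iff (mul_ne_zero (neg_ne_zero.mpr hden) hΓ') (mul_ne_zero hden hΓ)]
    linear_combination
      (-(Γ * (starRingEnd ℂ) δ - δ * (starRingEnd ℂ) Γ)) * (-hquant)
  have him : (β * ω / Γ).im = 0 := Complex.conj_eq_iff_im.mp hreal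
  -- the product of the two quantities is `|δ|² / |Γ|²`
  have hprod : (β * ω / Γ) * (δ / (α * ω))
      = ((Complex.normSq δ / Complex.normSq Γ : ℝ) : ℂ) := by
    push_cast
    rw [← Complex.mul_conj, ← Complex.mul_conj, hα, hβ]
    generalize Γ * (starRingEnd ℂ) δ - δ * (starRingEnd ℂ) Γ = D at hden
    field_simp
  have hre := congrArg Complex.re hprod
  rw [Complex.mul_re, him, Complex.ofReal_re] at hre
  have hpos : 0 < Complex.normSq δ / Complex.normSq Γ :=
    div_pos (Complex.normSq_pos.mpr hδ) (Complex.normSq_pos.mpr hΓ)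
  have := mul_neg_of_pos_of_neg hA hB
  linarith
end
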